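/- For a (general) multi-context system with single-valued semantic operators and m bridge rules in total (m = Σ_i |br_i|), the map sending an equilibrium S to the set of bridge rules satisfied in S is injective on equilibria; consequently the system has at most 2^m equilibria. -/

import Mathlib

/-- A general bridge rule: a head, a finite positive body and a finite negative body. -/
structure GRule (n : ℕ) (α : Type*) where
  head : α
  pbody : Finset (Fin n × α)
  nbody : Finset (Fin n × α)
deriving DecidableEq

/-- A general multi-context system with single-valued semantic operators. -/
structure GMCS (n : ℕ) (α : Type*) [DecidableEq α] where
  ACC : Fin n → Finset α → Finset α
  br : Fin n → Finset (GRule n α)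

variable {n : ℕ} {α : Type*} [DecidableEq α]

/-- A general bridge rule is satisfied in a belief state `S` iff every positive
body literal holds and no negative body literal holds. -/
def GSatisfied (r : GRule n α) (S : Fin n → Finset α) : Prop :=
  (∀ cp ∈ r.pbody, cp.2 ∈ S cp.1) ∧ ∀ cp ∈ r.nbody, cp.2 ∉ S cp.1

instance (r : GRule n α) (S : Fin n → Finset α) : Decidable (GSatisfied r S) := by
  unfold GSatisfied; infer_instance

/-- A belief state is an equilibrium iff each belief set is the result of applying
the semantic operator to the heads of the satisfied bridge rules of that context. -/
def IsGEquilibrium (M : GMCS n α) (S : Fin n → Finset α) : Prop :=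
  ∀ i, S i = M.ACC i (((M.br i).filter (fun r => GSatisfied r S)).image GRule.head)

/-- An equilibrium is determined by its context-indexed set of satisfied bridge rules. -/
theorem IsGEquilibrium.eq_of_filter_eq {M : GMCS n α} {S S' : Fin n → Finset α}
    (hS : IsGEquilibrium M S) (hS' : IsGEquilibrium M S')
    (h : ∀ i, (M.br i).filter (fun r => GSatisfied r S) =
      (M.br i).filter (fun r => GSatisfied r S')) : S = S' := by
  funext i
  rw [hS i, hS' i, h i]

/-- the map sending an equilibrium `S` to the (context-indexed) set of
bridge rules satisfied in `S` is injective on equilibria; consequently a general MCS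
with `m` bridge rules in total has at most `2 ^ m` equilibria. -/
theorem equilibria_injective_on_satisfied_rules_and_card_le (M : GMCS n α) (m : ℕ)
    (hm : m = ∑ i, (M.br i).card) :
    (∀ S S' : Fin n → Finset α, IsGEquilibrium M S → IsGEquilibrium M S' →
        (∀ i, (M.br i).filter (fun r => GSatisfied r S) =
              (M.br i).filter (fun r => GSatisfied r S')) → S = S') ∧
    {S : Fin n → Finset α | IsGEquilibrium M S}.Finite ∧
    {S : Fin n → Finset α | IsGEquilibrium M S}.ncard ≤ 2 ^ m := by
  let f : (Fin n → Finset α) → ∀ _ : Fin n, Finset (GRule n α) :=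
    fun S i => (M.br i).filter (fun r => GSatisfied r S)
  let T := Fintype.piFinset fun i => (M.br i).powerset
  have hmaps : Set.MapsTo f {S | IsGEquilibrium M S} (T : Set (Fin n → Finset (GRule n α))) :=
    fun S _ => Finset.mem_coe.2 <| Fintype.mem_piFinset.2 fun i =>
      Finset.mem_powerset.2 (Finset.filter_subset _ _)
  have hinj : Set.InjOn f {S | IsGEquilibrium M S} :=
    fun S hS S' hS' h => IsGEquilibrium.eq_of_filter_eq hS hS' (congrFun h)
  have hcard : T.card = 2 ^ m := by
    simp [T, Fintype.card_piFinset, Finset.prod_pow_eq_pow_sum, hm]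
  refine ⟨fun S S' hS hS' => hS.eq_of_filter_eq hS',
    Set.Finite.of_injOn hmaps hinj T.finite_toSet, ?_⟩
  rw [← hcard, ← Set.ncard_coe_finset T]
  exact Set.ncard_le_ncard_of_injOn f hmaps hinj T.finite_toSet
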